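/- Let S be a string of length n and let i', i, j ∈ [1,n] satisfy nss(i') = i, nss(i) = j, rlce(i', i) < i − i', and j < i + rlce(i', i). Then rlce(i,j) ≥ rlce(i', i) − (j − i). -/

import Mathlib

open List

variable {α : Type*} [LinearOrder α]

/-- The substring `S[i..j]` (1-based, both endpoints inclusive). -/
def sub (S : ℕ → α) (i j : ℕ) : List α := (List.range' i (j + 1 - i)).map S

/-- The suffix `S_i = S[i..n]` (empty for `i = n + 1`). -/
def suf (S : ℕ → α) (n i : ℕ) : List α := sub S i n

/-- The prefix `S[1..i]`. -/
def pre (S : ℕ → α) (i : ℕ) : List α := sub S 1 i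

/-- Strict lexicographic order `≺` on strings. -/
def slt (l₁ l₂ : List α) : Prop := List.Lex (· < ·) l₁ l₂

/-- Length of the longest common prefix of two lists. -/
def lcpLen (l₁ l₂ : List α) : ℕ :=
  Nat.findGreatest (fun k => l₁.take k = l₂.take k) (min l₁.length l₂.length)

/-- `rlce S n i j` : length of the longest common prefix of suffixes `S_i` and `S_j`. -/
def rlce (S : ℕ → α) (n i j : ℕ) : ℕ := lcpLen (suf S n i) (suf S n j)

/-- `llce S i j` : length of the longest common suffix of prefixes `S[1..i]` and `S[1..j]`. -/
def llce (S : ℕ → α) (i j : ℕ) : ℕ := lcpLen (pre S i).reverse (pre S j).reverse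

/-- Next-smaller-suffix array: `nss S n i = min { j | j = n+1 ∨ (i < j ≤ n ∧ S_j ≺ S_i) }`. -/
noncomputable def nss (S : ℕ → α) (n i : ℕ) : ℕ :=
  sInf {j | j = n + 1 ∨ (i < j ∧ j ≤ n ∧ slt (suf S n j) (suf S n i))}

/-- A Lyndon word: nonempty and strictly smaller than each of its non-trivial cyclic shifts. -/
def IsLyndon (l : List α) : Prop :=
  l ≠ [] ∧ ∀ k, 0 < k → k < l.length → slt l (l.drop k ++ l.take k)

/-- The Lyndon array: `lyn S n i = max { j - i + 1 | i ≤ j ≤ n, S[i..j] is a Lyndon word }`. -/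
noncomputable def lyn (S : ℕ → α) (n i : ℕ) : ℕ :=
  sSup {m | ∃ j, i ≤ j ∧ j ≤ n ∧ IsLyndon (sub S i j) ∧ m = j - i + 1}

/-- `p ≥ 1` is a period of `S[i..j]`: `S[x] = S[x+p]` for all `x ∈ [i, j - p]`. -/
def IsPeriod (S : ℕ → α) (i j p : ℕ) : Prop :=
  1 ≤ p ∧ ∀ x, i ≤ x → x + p ≤ j → S x = S (x + p)

/-- A run `(i,j,p)` in a string of length `n`. -/
def IsRun (S : ℕ → α) (n i j p : ℕ) : Prop :=
  1 ≤ i ∧ i ≤ j ∧ j ≤ n ∧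
  IsPeriod S i j p ∧ (∀ q, 1 ≤ q → q < p → ¬ IsPeriod S i j q) ∧
  2 * p ≤ j - i + 1 ∧
  (1 < i → ¬ IsPeriod S (i - 1) j p) ∧
  (j < n → ¬ IsPeriod S i (j + 1) p)

/-- A (lexicographically) decreasing run: a run with `S_i ≻ S_{i+p}`. -/
def IsDecRun (S : ℕ → α) (n i j p : ℕ) : Prop :=
  IsRun S n i j p ∧ slt (suf S n (i + p)) (suf S n i)

theorem length_suf {β : Type*} (S : ℕ → β) (n i : ℕ) :
    (suf S n i).length = n + 1 - i := by
  simp [suf, sub]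

theorem getElem_suf {β : Type*} (S : ℕ → β) (n i t : ℕ) (h : t < (suf S n i).length) :
    (suf S n i)[t] = S (i + t) := by
  simp [suf, sub]

theorem take_suf_eq_take_suf_iff {β : Type*} (S : ℕ → β) {n i j m : ℕ}
    (hi : m ≤ n + 1 - i) (hj : m ≤ n + 1 - j) :
    (suf S n i).take m = (suf S n j).take m ↔ ∀ t < m, S (i + t) = S (j + t) := by
  constructor
  · intro h t ht
    have h' := congrArg (fun l => l[t]?) h
    have hti : t < (suf S n i).length := by rw [length_suf]; omega
    have htj : t < (suf S n j).length := by rw [length_suf]; omega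
    simpa [List.getElem?_take, ht, List.getElem?_eq_getElem hti,
      List.getElem?_eq_getElem htj, getElem_suf] using h'
  · intro h
    apply List.ext_getElem
    · simp only [List.length_take, length_suf]; omega
    · intro t h₁ h₂
      simp only [List.getElem_take, getElem_suf]
      exact h t (by simp only [List.length_take] at h₁; omega)

theorem le_rlce_iff (S : ℕ → α) (n i j k : ℕ) :
    k ≤ rlce S n i j ↔
      k ≤ n + 1 - i ∧ k ≤ n + 1 - j ∧ ∀ t < k, S (i + t) = S (j + t) := by
  have hle : rlce S n i j ≤ min (n + 1 - i) (n + 1 - j) :=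
    (Nat.findGreatest_le _).trans_eq (by simp only [length_suf])
  have htake : (suf S n i).take (rlce S n i j) = (suf S n j).take (rlce S n i j) :=
    Nat.findGreatest_spec (P := fun k => (suf S n i).take k = (suf S n j).take k)
      (Nat.zero_le _) (by simp)
  constructor
  · intro h
    refine ⟨by omega, by omega, fun t ht => ?_⟩
    exact (take_suf_eq_take_suf_iff S (by omega) (by omega)).1 htake t (by omega)
  · rintro ⟨hi, hj, h⟩
    exact Nat.le_findGreatest (by simp only [length_suf]; omega)
      ((take_suf_eq_take_suf_iff S hi hj).2 h)

theorem slt_suf_iff (S : ℕ → α) (n i j : ℕ) :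
    slt (suf S n i) (suf S n j) ↔
      (n + 1 - i < n + 1 - j ∧ ∀ t < n + 1 - i, S (i + t) = S (j + t)) ∨
      ∃ e, e < n + 1 - i ∧ e < n + 1 - j ∧ (∀ t < e, S (i + t) = S (j + t)) ∧
        S (i + e) < S (j + e) := by
  change suf S n i < suf S n j ↔ _
  rw [List.lt_iff_exists]
  apply or_congr
  · rw [and_comm, length_suf, length_suf]
    refine and_congr_right fun hlt => ?_
    rw [← take_suf_eq_take_suf_iff S le_rfl hlt.le,
      List.take_of_length_le (length_suf S n i).le]
  · simp only [getElem_suf, length_suf, exists_prop]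

theorem nss_spec (S : ℕ → α) (n i : ℕ) (h : nss S n i ≤ n) :
    i < nss S n i ∧ slt (suf S n (nss S n i)) (suf S n i) := by
  have hmem : nss S n i ∈
      {j | j = n + 1 ∨ (i < j ∧ j ≤ n ∧ slt (suf S n j) (suf S n i))} :=
    Nat.sInf_mem ⟨n + 1, Or.inl rfl⟩
  rcases hmem with heq | ⟨hlt, -, hs⟩
  · omega
  · exact ⟨hlt, hs⟩

theorem nss_le (S : ℕ → α) {n i k : ℕ} (hik : i < k) (hk : k ≤ n)
    (h : slt (suf S n k) (suf S n i)) : nss S n i ≤ k :=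
  Nat.sInf_le (Or.inr ⟨hik, hk, h⟩)

/-- Case R2a: If `nss(i') = i`, `nss(i) = j`, `rlce(i',i) < i - i'`, and
`j < i + rlce(i',i)`, then `rlce(i,j) ≥ rlce(i',i) - (j - i)`. -/
theorem stmt_11 (S : ℕ → α) (n i' i j : ℕ)
    (hi'1 : 1 ≤ i') (hi'2 : i' ≤ n) (hi1 : 1 ≤ i) (hi2 : i ≤ n)
    (hj1 : 1 ≤ j) (hj2 : j ≤ n)
    (h1 : nss S n i' = i) (h2 : nss S n i = j)
    (h3 : rlce S n i' i < i - i') (h4 : j < i + rlce S n i' i) :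
    rlce S n i' i - (j - i) ≤ rlce S n i j := by
  have hij := nss_spec S n i (by omega)
  rw [h2] at hij
  obtain ⟨hij, hs⟩ := hij
  obtain ⟨-, hL, heq⟩ := (le_rlce_iff S n i' i _).1 le_rfl
  generalize rlce S n i' i = L at *
  rw [le_rlce_iff]
  refine ⟨by omega, by omega, fun t ht => ?_⟩
  rcases (slt_suf_iff S n j i).1 hs with ⟨-, h⟩ | ⟨e, he₁, he₂, h, hlt⟩
  · exact (h t (by omega)).symm
  · by_cases hte : t < e
    · exact (h t hte).symm
    exfalso
    have hshift : ∀ x, x + (j - i) < L → S (i' + (j - i) + x) = S (j + x) := by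
      intro x hx
      have hx' := heq (x + (j - i)) hx
      rwa [show i' + (x + (j - i)) = i' + (j - i) + x by omega,
        show i + (x + (j - i)) = j + x by omega] at hx'
    have hsmall : slt (suf S n (i' + (j - i))) (suf S n i') := by
      rw [slt_suf_iff]
      refine Or.inr ⟨e, by omega, by omega, fun x hx => ?_, ?_⟩
      · rw [hshift x (by omega), h x hx, heq x (by omega)]
      · rwa [hshift e (by omega), heq e (by omega)]
    have := nss_le S (by omega) (by omega) hsmall
    omega
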